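/- For every integer k ≥ 10, the integer n_k = L_{8k} + L_{6k} + L_{4k} + L_{2k} − 1 satisfies s_F(n_k³) = 60. -/

import Mathlib

/-- Zeckendorf sum of digits: number of summands in the Zeckendorf
representation of `n` (equivalently, minimal number of Fibonacci numbers
needed to write `n` as a sum of Fibonacci numbers). -/
def sF (n : ℕ) : ℕ := (Nat.zeckendorf n).length

/-- Lucas numbers: `L 0 = 2`, `L k = F (k-1) + F (k+1)` for `k ≥ 1`. -/
def lucas : ℕ → ℕ
  | 0 => 2
  | k + 1 => Nat.fib k + Nat.fib (k + 2)

open Real in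
theorem coe_lucas (n : ℕ) : (lucas n : ℝ) = goldenRatio ^ n + goldenConj ^ n := by
  induction n using Nat.twoStepInduction with
  | zero => norm_num [lucas]
  | one => simp [lucas, goldenRatio_add_goldenConj]
  | more n h₀ h₁ =>
    have h : lucas (n + 2) = lucas n + lucas (n + 1) := by
      cases n with
      | zero => rfl
      | succ n =>
        simp only [lucas, Nat.fib_add_two]
        ring
    rw [h, Nat.cast_add, h₀, h₁, pow_add _ n 2, pow_add _ n 2, goldenRatio_sq, goldenConj_sq]
    ring

theorem lucas_pos (n : ℕ) : 0 < lucas n := by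
  cases n with
  | zero => simp [lucas]
  | succ n => simp [lucas]

open Real in
theorem lucas_sum_cube (k : ℕ) :
    (lucas (8 * k) + lucas (6 * k) + lucas (4 * k) + lucas (2 * k) - 1) ^ 3 =
      1 * lucas (24 * k) + 3 * lucas (22 * k) + 6 * lucas (20 * k) + 10 * lucas (18 * k) +
      9 * lucas (16 * k) + 9 * lucas (14 * k) + 10 * lucas (12 * k) + 12 * lucas (10 * k) +
      27 * lucas (8 * k) + 28 * lucas (6 * k) + 27 * lucas (4 * k) + 24 * lucas (2 * k) + 11 := by
  have h : 1 ≤ lucas (8 * k) + lucas (6 * k) + lucas (4 * k) + lucas (2 * k) :=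
    le_add_left (lucas_pos _)
  rw [← Nat.cast_inj (R := ℝ)]
  push_cast [Nat.cast_sub h]
  have hL (j : ℕ) : (lucas (2 * j * k) : ℝ) =
      (goldenRatio ^ (2 * k)) ^ j + ((goldenRatio ^ (2 * k))⁻¹) ^ j := by
    have hinv : (goldenRatio ^ (2 * k))⁻¹ = goldenConj ^ (2 * k) := by
      rw [← inv_pow, inv_goldenRatio, (even_two_mul k).neg_pow]
    rw [coe_lucas, hinv, ← pow_mul, ← pow_mul, mul_right_comm]
  have h1 := hL 1
  have h2 := hL 2
  have h3 := hL 3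
  have h4 := hL 4
  have h5 := hL 5
  have h6 := hL 6
  have h7 := hL 7
  have h8 := hL 8
  have h9 := hL 9
  have h10 := hL 10
  have h11 := hL 11
  have h12 := hL 12
  norm_num only at h1 h2 h3 h4 h5 h6 h7 h8 h9 h10 h11 h12
  rw [h1, h2, h3, h4, h5, h6, h7, h8, h9, h10, h11, h12]
  have hx : goldenRatio ^ (2 * k) ≠ 0 := pow_ne_zero _ goldenRatio_ne_zero
  generalize goldenRatio ^ (2 * k) = x at hx
  field_simp
  ring

/-- If the Fibonacci numbers with indices `l` add up to `c` times the Lucas number `76` (of index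
`9`), and those with indices raised by one to `c` times the next Lucas number `123`, then the same
relation holds for every larger shift. -/
theorem sum_fib_shift_eq_mul_lucas {m : ℕ} (c : ℕ) (hm : 10 ≤ m) (l : List ℕ)
    (h₀ : (l.map Nat.fib).sum = c * 76)
    (h₁ : (l.map fun i ↦ Nat.fib (i + 1)).sum = c * 123) :
    ((l.map (m - 9 + ·)).map Nat.fib).sum = c * lucas m := by
  obtain ⟨t, rfl⟩ := Nat.exists_eq_add_of_le' hm
  rw [show t + 10 - 9 = t + 1 by omega]
  have key : ((l.map (t + 1 + ·)).map Nat.fib).sum =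
      Nat.fib t * (l.map Nat.fib).sum +
        Nat.fib (t + 1) * (l.map fun i ↦ Nat.fib (i + 1)).sum := by
    clear h₀ h₁
    induction l with
    | nil => simp
    | cons a l ih =>
      simp only [List.map_cons, List.sum_cons, ih]
      rw [add_right_comm t 1 a, Nat.fib_add]
      ring
  have hl : lucas (t + 10) = Nat.fib t * 76 + Nat.fib (t + 1) * 123 := by
    have h₈ : Nat.fib (t + 9) = Nat.fib t * 21 + Nat.fib (t + 1) * 34 := Nat.fib_add t 8
    have h₁₀ : Nat.fib (t + 11) = Nat.fib t * 55 + Nat.fib (t + 1) * 89 := Nat.fib_add t 10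
    change Nat.fib (t + 9) + Nat.fib (t + 11) = _
    omega
  rw [key, h₀, h₁, hl]
  ring

theorem stmt_19 (k : ℕ) (hk : 10 ≤ k) :
    sF ((lucas (8 * k) + lucas (6 * k) + lucas (4 * k) + lucas (2 * k) - 1) ^ 3) = 60 := by
  let block (t : ℕ) (l : List ℕ) : List ℕ := l.map (t - 9 + ·)
  let l : List ℕ := List.flatten [
      block (24 * k) [10, 8],
      block (22 * k) [12, 10, 8, 6],
      block (20 * k) [14, 10, 8, 4],
      block (18 * k) [15, 12, 5, 2],
      block (16 * k) [15, 10, 7, 5, 2],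
      block (14 * k) [15, 10, 7, 5, 2],
      block (12 * k) [15, 12, 5, 2],
      block (10 * k) [15, 13, 10, 7, 2],
      block (8 * k) [17, 14, 10, 8, 3, 0],
      block (6 * k) [17, 14, 12, 6, 3, 0],
      block (4 * k) [17, 14, 10, 8, 3, 0],
      block (2 * k) [17, 12, 10, 8, 5, 3, 0],
      [6, 4]]
  have hl : l.IsZeckendorfRep := by
    simp only [l, block, List.IsZeckendorfRep, List.flatten_cons, List.flatten_nil,
      List.map_cons, List.map_nil, List.cons_append, List.nil_append, List.append_nil,
      List.isChain_cons_cons, List.isChain_singleton, and_true]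
    omega
  have h12 := sum_fib_shift_eq_mul_lucas 1 (show 10 ≤ 24 * k by omega)
    [10, 8] (by decide) (by decide)
  have h11 := sum_fib_shift_eq_mul_lucas 3 (show 10 ≤ 22 * k by omega)
    [12, 10, 8, 6] (by decide) (by decide)
  have h10 := sum_fib_shift_eq_mul_lucas 6 (show 10 ≤ 20 * k by omega)
    [14, 10, 8, 4] (by decide) (by decide)
  have h9 := sum_fib_shift_eq_mul_lucas 10 (show 10 ≤ 18 * k by omega)
    [15, 12, 5, 2] (by decide) (by decide)
  have h8 := sum_fib_shift_eq_mul_lucas 9 (show 10 ≤ 16 * k by omega)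
    [15, 10, 7, 5, 2] (by decide) (by decide)
  have h7 := sum_fib_shift_eq_mul_lucas 9 (show 10 ≤ 14 * k by omega)
    [15, 10, 7, 5, 2] (by decide) (by decide)
  have h6 := sum_fib_shift_eq_mul_lucas 10 (show 10 ≤ 12 * k by omega)
    [15, 12, 5, 2] (by decide) (by decide)
  have h5 := sum_fib_shift_eq_mul_lucas 12 (show 10 ≤ 10 * k by omega)
    [15, 13, 10, 7, 2] (by decide) (by decide)
  have h4 := sum_fib_shift_eq_mul_lucas 27 (show 10 ≤ 8 * k by omega)
    [17, 14, 10, 8, 3, 0] (by decide) (by decide)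
  have h3 := sum_fib_shift_eq_mul_lucas 28 (show 10 ≤ 6 * k by omega)
    [17, 14, 12, 6, 3, 0] (by decide) (by decide)
  have h2 := sum_fib_shift_eq_mul_lucas 27 (show 10 ≤ 4 * k by omega)
    [17, 14, 10, 8, 3, 0] (by decide) (by decide)
  have h1 := sum_fib_shift_eq_mul_lucas 24 (show 10 ≤ 2 * k by omega)
    [17, 12, 10, 8, 5, 3, 0] (by decide) (by decide)
  have h0 : ([6, 4].map Nat.fib).sum = 11 := by decide
  have hsum : (l.map Nat.fib).sum =
      (lucas (8 * k) + lucas (6 * k) + lucas (4 * k) + lucas (2 * k) - 1) ^ 3 := by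
    rw [lucas_sum_cube]
    simp only [l, block, List.flatten_cons, List.flatten_nil, List.append_nil, List.map_append,
      List.sum_append, h12, h11, h10, h9, h8, h7, h6, h5, h4, h3, h2, h1, h0]
    ring
  rw [sF, ← hsum, Nat.zeckendorf_sum_fib hl]
  rfl
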